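/- arXiv:2502.12381 — 2 statements merged into one kernel-verified Lean document; each statement's English description precedes it below -/
import Mathlib

section
/- Let T ≥ 1, let K be a T×T real symmetric matrix with K t s ≥ 0 for all t,s and with constant row sums (∑_s K t s is the same for all t, so that K − diag(K·𝟙) is symmetric), let δt satisfy 0 < δt and δt · (∑_{s=1}^T K t s) ≤ 1 for every t, and define A := I + δt·(K − diag(K·𝟙)). Then A is a symmetric doubly stochastic matrix and the diffusion update is non-expansive in the Euclidean norm: for every x ∈ ℝ^T, ‖A ·ᵥ x‖₂ ≤ ‖x‖₂. -/
open Matrix Finset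

/-- A doubly stochastic matrix is non-expansive in the Euclidean norm. -/
theorem norm_toEuclideanLin_le_of_mem_doublyStochastic {n : Type*} [Fintype n] [DecidableEq n]
    {M : Matrix n n ℝ} (hM : M ∈ doublyStochastic ℝ n) (x : EuclideanSpace ℝ n) :
    ‖Matrix.toEuclideanLin M x‖ ≤ ‖x‖ := by
  refine le_of_sq_le_sq ?_ (norm_nonneg x)
  rw [EuclideanSpace.real_norm_sq_eq, EuclideanSpace.real_norm_sq_eq]
  calc ∑ i, (Matrix.toEuclideanLin M x) i ^ 2
      = ∑ i, (∑ j, M i j * x j) ^ 2 := by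
        simp [Matrix.toLpLin_apply, Matrix.mulVec, dotProduct]
    _ ≤ ∑ i, ∑ j, M i j * x j ^ 2 := by
        gcongr with i
        exact Real.pow_arith_mean_le_arith_mean_pow_of_even _ _ _
          (fun j _ => nonneg_of_mem_doublyStochastic hM) (sum_row_of_mem_doublyStochastic hM i)
          even_two
    _ = ∑ j, x j ^ 2 := by
        rw [Finset.sum_comm]
        simp [← Finset.sum_mul, sum_col_of_mem_doublyStochastic hM]

/-- For a symmetric nonnegative kernel with constant row sums, the effective
diffusion operator `A = I + δt·(K − diag(K·𝟙))` is a symmetric doubly stochastic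
matrix and the diffusion update is non-expansive in the Euclidean norm. -/
theorem diffusion_symmetric_doubly_stochastic_nonexpansive
    (T : ℕ) (hT : 1 ≤ T)
    (K : Matrix (Fin T) (Fin T) ℝ)
    (hKsymm : K.IsSymm)
    (hK : ∀ t s, 0 ≤ K t s)
    (hrow : ∀ t t' : Fin T, ∑ s, K t s = ∑ s, K t' s)
    (δt : ℝ) (hδt : 0 < δt)
    (hstep : ∀ t : Fin T, δt * (∑ s, K t s) ≤ 1)
    (A : Matrix (Fin T) (Fin T) ℝ)
    (hA : A = 1 + δt • (K - Matrix.diagonal fun t => ∑ s, K t s)) :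
    A.IsSymm ∧
    (∀ t s : Fin T, 0 ≤ A t s) ∧
    (∀ t : Fin T, ∑ s, A t s = 1) ∧
    (∀ s : Fin T, ∑ t, A t s = 1) ∧
    (∀ x : EuclideanSpace ℝ (Fin T), ‖Matrix.toEuclideanLin A x‖ ≤ ‖x‖) := by
  have hsymm : A.IsSymm := by
    subst hA
    exact Matrix.isSymm_one.add ((hKsymm.sub (Matrix.isSymm_diagonal _)).smul δt)
  have hnonneg : ∀ t s, 0 ≤ A t s := by
    intro t s
    subst hA
    have hKts := mul_nonneg hδt.le (hK t s)
    rcases eq_or_ne t s with rfl | hts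
    · simp only [Matrix.add_apply, Matrix.one_apply_eq, Matrix.smul_apply, Matrix.sub_apply,
        Matrix.diagonal_apply_eq, smul_eq_mul]
      linarith [hstep t]
    · simpa [hts] using hKts
  have hsum : ∀ t, ∑ s, A t s = 1 := by
    intro t
    subst hA
    simp [Finset.sum_add_distrib, ← Finset.mul_sum, Matrix.one_apply, Matrix.diagonal_apply]
  have hsum' : ∀ s, ∑ t, A t s = 1 := fun s => by
    simpa only [hsymm.apply] using hsum s
  exact ⟨hsymm, hnonneg, hsum, hsum', norm_toEuclideanLin_le_of_mem_doublyStochastic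
    (mem_doublyStochastic_iff_sum.2 ⟨hnonneg, hsum, hsum'⟩)⟩
end

section
/- Let T ≥ 1, let K be a T×T real matrix with K t s ≥ 0 for all t,s, let δt satisfy 0 < δt and δt · (∑_{s=1}^T K t s) ≤ 1 for every t, and define A := I + δt·(K − diag(K·𝟙)). Let E be a real normed vector space and h : Fin T → E. Then for every number of layers L and every t, ‖((A^L) h) t‖ ≤ max_s ‖h s‖, where ((A^L) h) t := ∑_s ((A^L) t s) • h s. In other words, the hidden-state norms do not increase no matter how many diffusion layers are stacked. -/
open Matrix Finset

/-- A weighted average of vectors with weights from a row of a row-stochastic matrix has norm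
at most the maximal norm. -/
theorem norm_sum_smul_le_iSup_of_mem_rowStochastic {ι E : Type*} [Fintype ι] [DecidableEq ι]
    [SeminormedAddCommGroup E] [NormedSpace ℝ E] {M : Matrix ι ι ℝ}
    (hM : M ∈ rowStochastic ℝ ι) (h : ι → E) (t : ι) :
    ‖∑ s, M t s • h s‖ ≤ ⨆ s, ‖h s‖ := by
  calc ‖∑ s, M t s • h s‖ ≤ ∑ s, M t s * ⨆ s, ‖h s‖ := by
        refine norm_sum_le_of_le _ fun s _ => ?_
        rw [norm_smul, Real.norm_of_nonneg (nonneg_of_mem_rowStochastic hM)]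
        exact mul_le_mul_of_nonneg_left (le_ciSup (Set.finite_range fun s => ‖h s‖).bddAbove s)
          (nonneg_of_mem_rowStochastic hM)
    _ = ⨆ s, ‖h s‖ := by
        rw [← Finset.sum_mul, sum_row_of_mem_rowStochastic hM, one_mul]

/-- The explicit diffusion step is row-stochastic under the time step condition. -/
theorem one_add_smul_sub_diagonal_mem_rowStochastic {ι : Type*} [Fintype ι] [DecidableEq ι]
    {K : Matrix ι ι ℝ} (hK : ∀ t s, 0 ≤ K t s) {δ : ℝ} (hδ : 0 ≤ δ)
    (hstep : ∀ t, δ * (∑ s, K t s) ≤ 1) :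
    1 + δ • (K - Matrix.diagonal fun t => ∑ s, K t s) ∈ rowStochastic ℝ ι := by
  rw [mem_rowStochastic_iff_sum]
  refine ⟨fun t s => ?_, fun t => ?_⟩
  · have hKδ := mul_nonneg hδ (hK t s)
    rcases eq_or_ne t s with rfl | hts
    · simp only [Matrix.add_apply, Matrix.smul_apply, Matrix.sub_apply, Matrix.one_apply_eq,
        Matrix.diagonal_apply_eq, smul_eq_mul]
      linarith [hstep t]
    · simpa [Matrix.one_apply_ne hts, Matrix.diagonal_apply_ne _ hts] using hKδ
  · simp [Finset.sum_add_distrib, ← Finset.mul_sum, Matrix.one_apply, Matrix.diagonal_apply]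

/-- Hidden-state norms do not increase no matter how many diffusion layers are
stacked: after `L` layers, every hidden state `∑_s (A^L) t s • h s` has norm at
most the maximal initial hidden-state norm. -/
theorem diffusion_layers_nonexpansive
    (T : ℕ) (hT : 1 ≤ T)
    (K : Matrix (Fin T) (Fin T) ℝ)
    (hK : ∀ t s, 0 ≤ K t s)
    (δt : ℝ) (hδt : 0 < δt)
    (hstep : ∀ t : Fin T, δt * (∑ s, K t s) ≤ 1)
    (A : Matrix (Fin T) (Fin T) ℝ)
    (hA : A = 1 + δt • (K - Matrix.diagonal fun t => ∑ s, K t s))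
    (E : Type*) [NormedAddCommGroup E] [NormedSpace ℝ E]
    (h : Fin T → E) :
    ∀ (L : ℕ) (t : Fin T), ‖∑ s, (A ^ L) t s • h s‖ ≤ ⨆ s : Fin T, ‖h s‖ := by
  intro L t
  subst hA
  exact norm_sum_smul_le_iSup_of_mem_rowStochastic
    (pow_mem (one_add_smul_sub_diagonal_mem_rowStochastic hK hδt.le hstep) L) h t
end
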